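/- arXiv:0711.4165 — 2 statements merged into one kernel-verified Lean document; each statement's English description precedes it below -/
import Mathlib

section
/- Let G be a group, let H and K be subgroups of G such that K normalizes H, and let t be an element of G that inverts H elementwise (t⁻¹ht = h⁻¹ for all h ∈ H) and inverts K elementwise (t⁻¹kt = k⁻¹ for all k ∈ K). If K is 2-divisible, then every element of K commutes with every element of H, i.e. the commutator subgroup [K,H] is trivial. -/
/-- Inversion–commutation lemma (paper Lemma 7.10): if `K` normalizes `H`,
`t` inverts both `H` and `K` elementwise, and `K` is 2-divisible, then every
element of `K` commutes with every element of `H`, i.e. `⁅K, H⁆ = ⊥`. -/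
theorem stmt_0 {G : Type*} [Group G] (H K : Subgroup G) (t : G)
    (hnorm : ∀ k ∈ K, ∀ h ∈ H, k * h * k⁻¹ ∈ H)
    (hinvH : ∀ h ∈ H, t⁻¹ * h * t = h⁻¹)
    (hinvK : ∀ k ∈ K, t⁻¹ * k * t = k⁻¹)
    (hdiv : ∀ k ∈ K, ∃ x ∈ K, x * x = k) :
    (∀ k ∈ K, ∀ h ∈ H, k * h = h * k) ∧ ⁅K, H⁆ = (⊥ : Subgroup G) := by
  have hcomm : ∀ k ∈ K, ∀ h ∈ H, k * h = h * k := by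
    intro k hk h hh
    obtain ⟨x, hx, rfl⟩ := hdiv k hk
    have hconj : x⁻¹ * h⁻¹ * x = (x * h * x⁻¹)⁻¹ := by
      calc x⁻¹ * h⁻¹ * x = x⁻¹ * h⁻¹ * (x⁻¹)⁻¹ := by rw [inv_inv]
        _ = (t⁻¹ * x * t) * (t⁻¹ * h * t) * (t⁻¹ * x * t)⁻¹ := by rw [hinvK x hx, hinvH h hh]
        _ = t⁻¹ * (x * h * x⁻¹) * t := by group
        _ = (x * h * x⁻¹)⁻¹ := hinvH _ (hnorm x hx h hh)
    have hconj' : x⁻¹ * h * x = x * h * x⁻¹ := by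
      rw [← inv_inj, ← hconj]
      group
    calc x * x * h = x * (x * h * x⁻¹) * x := by group
      _ = x * (x⁻¹ * h * x) * x := by rw [hconj']
      _ = h * (x * x) := by group
  refine ⟨hcomm, Subgroup.commutator_eq_bot_iff_le_centralizer.mpr fun k hk => ?_⟩
  exact Subgroup.mem_centralizer_iff.mpr fun h hh => (hcomm k hk h hh).symm
end

section
/- Let G be a group, let w ∈ G satisfy w² = 1, and let H be a subgroup of G normalized by w. Set S = {a ∈ H : w⁻¹aw = a⁻¹}, and let A be the subgroup of G generated by {a² : a ∈ S}. Suppose that A is abelian and that every element of A is the square of some element of A. Then w inverts A elementwise (w⁻¹xw = x⁻¹ for all x ∈ A), and A = {a² : a ∈ S}; that is, the set of squares of w-inverted elements of H is itself a subgroup. -/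
/-- If an endomorphism inverts a set `T` elementwise and the subgroup generated by `T` is
commutative, then it inverts that subgroup elementwise. -/
theorem Subgroup.map_eq_inv_of_mem_closure {G : Type*} [Group G] (f : G →* G) {T : Set G}
    (hT : ∀ x ∈ T, f x = x⁻¹)
    (hcomm : ∀ x ∈ closure T, ∀ y ∈ closure T, x * y = y * x) {x : G} (hx : x ∈ closure T) :
    f x = x⁻¹ := by
  induction hx using closure_induction with
  | mem x hx => exact hT x hx
  | one => simp
  | mul x y hx hy ihx ihy => rw [map_mul, ihx, ihy, hcomm x hx y hy, mul_inv_rev]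
  | inv x _ ih => rw [map_inv, ih]

/-- The claim following Lemma 7.8: with `S` the set of elements of `H`
inverted by the involution `w`, and `A = ⟨a² : a ∈ S⟩` abelian and 2-divisible,
`w` inverts `A` elementwise and `A` is exactly the set `{a² : a ∈ S}`. -/
theorem stmt_5 {G : Type*} [Group G] (w : G) (hw : w ^ 2 = 1)
    (H : Subgroup G) (hnorm : ∀ h ∈ H, w⁻¹ * h * w ∈ H)
    (S : Set G) (hS : S = {a : G | a ∈ H ∧ w⁻¹ * a * w = a⁻¹})
    (A : Subgroup G) (hA : A = Subgroup.closure ((fun a => a * a) '' S))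
    (habel : ∀ x ∈ A, ∀ y ∈ A, x * y = y * x)
    (hdiv : ∀ x ∈ A, ∃ y ∈ A, y * y = x) :
    (∀ x ∈ A, w⁻¹ * x * w = x⁻¹) ∧ (A : Set G) = (fun a => a * a) '' S := by
  subst hS hA
  have hinv : ∀ x ∈ Subgroup.closure ((fun a => a * a) '' {a : G | a ∈ H ∧ w⁻¹ * a * w = a⁻¹}),
      w⁻¹ * x * w = x⁻¹ := by
    intro x hx
    have h := Subgroup.map_eq_inv_of_mem_closure (MulAut.conj w⁻¹).toMonoidHom ?_ habel hx
    · simpa using h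
    · rintro _ ⟨a, ⟨-, ha⟩, rfl⟩
      have h : MulAut.conj w⁻¹ a = a⁻¹ := by simpa using ha
      change MulAut.conj w⁻¹ (a * a) = (a * a)⁻¹
      rw [map_mul, h, mul_inv_rev]
  refine ⟨hinv, Set.Subset.antisymm (fun x hx => ?_) Subgroup.subset_closure⟩
  obtain ⟨y, hy, rfl⟩ := hdiv x hx
  refine ⟨y, ⟨(Subgroup.closure_le H).mpr ?_ hy, hinv y hy⟩, rfl⟩
  rintro _ ⟨a, ⟨ha, -⟩, rfl⟩
  exact H.mul_mem ha ha
end
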